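/- For every minimizer P* of MMOT(μ) and every ε ≥ 0: MMOT(μ) ≤ MMOT-DC_ε((T_m)_{m=1}^M, μ) ≤ MMOT(μ) + ε · KL(P* | P*_{#T}). -/

import Mathlib

open scoped BigOperators

namespace MMOTPaper

variable {N M : ℕ}

/-- Frobenius inner product of two tensors. -/
def inner' {ι : Type*} [Fintype ι] (C P : ι → ℝ) : ℝ := ∑ x, C x * P x

/-- A probability tensor: nonnegative entries summing to 1. -/
def IsProb {ι : Type*} [Fintype ι] (P : ι → ℝ) : Prop :=
  (∀ x, 0 ≤ P x) ∧ ∑ x, P x = 1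

/-- Negative entropy `H(P) = ∑ P log P`. -/
noncomputable def negEnt {ι : Type*} [Fintype ι] (P : ι → ℝ) : ℝ :=
  ∑ x, P x * Real.log (P x)

/-- Kullback-Leibler divergence; `⊤` if `μ` is not absolutely continuous w.r.t. `ν`. -/
noncomputable def KL {ι : Type*} [Fintype ι] (μ ν : ι → ℝ) : EReal :=
  if ∀ x, ν x = 0 → μ x = 0 then ((∑ x, μ x * Real.log (μ x / ν x) : ℝ) : EReal)
  else ⊤

/-- `n`-th marginal vector of a tensor. -/
def marg1 (a : Fin N → ℕ) (P : ((n : Fin N) → Fin (a n)) → ℝ) (n : Fin N)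
    (i : Fin (a n)) : ℝ :=
  ∑ x : (n : Fin N) → Fin (a n), if x n = i then P x else 0

/-- The set `U_T` of admissible couplings: probability tensors with marginals `μ n`. -/
def UT (a : Fin N → ℕ) (μ : (n : Fin N) → Fin (a n) → ℝ) :
    Set (((n : Fin N) → Fin (a n)) → ℝ) :=
  {P | IsProb P ∧ ∀ n i, marg1 a P n i = μ n i}

/-- A tuple partition of `(1,…,N)` into `M` blocks, encoded by the block assignment map:
monotonicity says the blocks are tuples of consecutive indices concatenating to `T`,
surjectivity says each block is nonempty. -/
def IsPartition (part : Fin N → Fin M) : Prop :=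
  Monotone part ∧ Function.Surjective part

/-- Restriction of a full index to the coordinates of block `m`. -/
def restr (a : Fin N → ℕ) (part : Fin N → Fin M) (m : Fin M)
    (x : (n : Fin N) → Fin (a n)) : (n : {n : Fin N // part n = m}) → Fin (a n.1) :=
  fun n => x n.1

/-- The `T_m`-marginal tensor `P_{#m}` of `P`: sum over all dimensions not in block `m`. -/
def margBlock (a : Fin N → ℕ) (part : Fin N → Fin M) (m : Fin M)
    (P : ((n : Fin N) → Fin (a n)) → ℝ)
    (y : (n : {n : Fin N // part n = m}) → Fin (a n.1)) : ℝ :=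
  ∑ x : (n : Fin N) → Fin (a n), if restr a part m x = y then P x else 0

/-- Tensor product of block tensors. -/
def tprod (a : Fin N → ℕ) (part : Fin N → Fin M)
    (Q : (m : Fin M) → ((n : {n : Fin N // part n = m}) → Fin (a n.1)) → ℝ)
    (x : (n : Fin N) → Fin (a n)) : ℝ :=
  ∏ m, Q m (restr a part m x)

/-- `P_{#T}`: the tensor product of the block marginals of `P`. -/
def prodMarg (a : Fin N → ℕ) (part : Fin N → Fin M)
    (P : ((n : Fin N) → Fin (a n)) → ℝ) : ((n : Fin N) → Fin (a n)) → ℝ :=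
  tprod a part (fun m => margBlock a part m P)

/-- The product tensor `μ_1 ⊗ … ⊗ μ_N`. -/
def prodMu (a : Fin N → ℕ) (μ : (n : Fin N) → Fin (a n) → ℝ)
    (x : (n : Fin N) → Fin (a n)) : ℝ :=
  ∏ n, μ n (x n)

/-- The set `F_M` of admissible couplings factorizing as a tensor product
of probability tensors indexed by the blocks. -/
def FM (a : Fin N → ℕ) (μ : (n : Fin N) → Fin (a n) → ℝ) (part : Fin N → Fin M) :
    Set (((n : Fin N) → Fin (a n)) → ℝ) :=
  {P | P ∈ UT a μ ∧
    ∃ Q : (m : Fin M) → ((n : {n : Fin N // part n = m}) → Fin (a n.1)) → ℝ,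
      (∀ m, IsProb (Q m)) ∧ P = tprod a part Q}

/-- The MMOT value `inf_{P ∈ U_T} ⟨C, P⟩`. -/
noncomputable def MMOTval (a : Fin N → ℕ) (μ : (n : Fin N) → Fin (a n) → ℝ)
    (C : ((n : Fin N) → Fin (a n)) → ℝ) : ℝ :=
  sInf ((fun P => inner' C P) '' UT a μ)

/-- The F-MMOT value `inf_{P ∈ F_M} ⟨C, P⟩`. -/
noncomputable def FMMOTval (a : Fin N → ℕ) (μ : (n : Fin N) → Fin (a n) → ℝ)
    (part : Fin N → Fin M) (C : ((n : Fin N) → Fin (a n)) → ℝ) : ℝ :=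
  sInf ((fun P => inner' C P) '' FM a μ part)

/-- The MMOT-DC objective `⟨C, P⟩ + ε KL(P | P_{#T})`. -/
noncomputable def dcObj (a : Fin N → ℕ) (part : Fin N → Fin M)
    (C : ((n : Fin N) → Fin (a n)) → ℝ) (ε : ℝ)
    (P : ((n : Fin N) → Fin (a n)) → ℝ) : EReal :=
  ((inner' C P : ℝ) : EReal) + (ε : EReal) * KL P (prodMarg a part P)

/-- The MMOT-DC value `inf_{P ∈ U_T} ⟨C, P⟩ + ε KL(P | P_{#T})`. -/
noncomputable def MMOTDCval (a : Fin N → ℕ) (μ : (n : Fin N) → Fin (a n) → ℝ)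
    (part : Fin N → Fin M) (C : ((n : Fin N) → Fin (a n)) → ℝ) (ε : ℝ) : EReal :=
  ⨅ P ∈ UT a μ, dcObj a part C ε P

lemma sum_margBlock (a : Fin N → ℕ) (part : Fin N → Fin M) (m : Fin M)
    (P : ((n : Fin N) → Fin (a n)) → ℝ) : ∑ y, margBlock a part m P y = ∑ x, P x := by
  unfold margBlock
  rw [Finset.sum_comm]
  simp

/-- A full index is the same as a family of block indices. -/
def blockEquiv (a : Fin N → ℕ) (part : Fin N → Fin M) :
    ((n : Fin N) → Fin (a n)) ≃
      ((m : Fin M) → (n : {n : Fin N // part n = m}) → Fin (a n.1)) where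
  toFun x m := restr a part m x
  invFun g n := g (part n) ⟨n, rfl⟩
  left_inv x := rfl
  right_inv g := by
    funext m n
    obtain ⟨n, h⟩ := n
    subst h
    rfl

lemma sum_tprod (a : Fin N → ℕ) (part : Fin N → Fin M)
    (Q : (m : Fin M) → ((n : {n : Fin N // part n = m}) → Fin (a n.1)) → ℝ) :
    ∑ x, tprod a part Q x = ∏ m, ∑ y, Q m y := by
  rw [Finset.prod_univ_sum, Fintype.piFinset_univ]
  exact Fintype.sum_equiv (blockEquiv a part) _ _ (fun x => rfl)

lemma KL_nonneg {ι : Type*} [Fintype ι] (P ν : ι → ℝ) (hP : IsProb P) (hν : IsProb ν) :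
    0 ≤ KL P ν := by
  unfold KL
  split_ifs with h
  · rw [EReal.coe_nonneg]
    have key : ∀ x, P x - ν x ≤ P x * Real.log (P x / ν x) := by
      intro x
      rcases (hP.1 x).eq_or_lt with h0 | h0
      · rw [← h0]; simpa using hν.1 x
      · have hn : 0 < ν x := lt_of_le_of_ne (hν.1 x) (fun e => h0.ne' (h x e.symm))
        have h1 := Real.log_le_sub_one_of_pos (div_pos hn h0)
        have h2 : Real.log (P x / ν x) = - Real.log (ν x / P x) := by
          rw [← Real.log_inv, inv_div]
        have h3 := mul_le_mul_of_nonneg_left h1 h0.le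
        have h4 : P x * (ν x / P x - 1) = ν x - P x := by field_simp
        rw [h2]
        linarith
    have := Finset.sum_le_sum (fun x (_ : x ∈ Finset.univ) => key x)
    rw [Finset.sum_sub_distrib, hP.2, hν.2, sub_self] at this
    exact this
  · exact le_top

lemma prodMarg_isProb (a : Fin N → ℕ) (part : Fin N → Fin M)
    (P : ((n : Fin N) → Fin (a n)) → ℝ) (hP : IsProb P) : IsProb (prodMarg a part P) := by
  refine ⟨fun x => ?_, ?_⟩
  · unfold prodMarg tprod margBlock
    refine Finset.prod_nonneg fun m _ => Finset.sum_nonneg fun z _ => ?_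
    split_ifs
    · exact hP.1 z
    · exact le_rfl
  · unfold prodMarg
    rw [sum_tprod]
    simp [sum_margBlock, hP.2]

/-- For every minimizer `P*` of `MMOT(μ)` and every `ε ≥ 0`:
`MMOT(μ) ≤ MMOT-DC_ε ≤ MMOT(μ) + ε·KL(P* | P*_{#T})`. -/
theorem mmotdc_sandwich {N M : ℕ} (hN : 0 < N) (hM : 0 < M)
    (a : Fin N → ℕ) (ha : ∀ n, 0 < a n)
    (μ : (n : Fin N) → Fin (a n) → ℝ) (hμ : ∀ n, IsProb (μ n))
    (part : Fin N → Fin M) (hpart : IsPartition part)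
    (C : ((n : Fin N) → Fin (a n)) → ℝ)
    (Pstar : ((n : Fin N) → Fin (a n)) → ℝ) (hPstarMem : Pstar ∈ UT a μ)
    (hPstarMin : ∀ Q ∈ UT a μ, inner' C Pstar ≤ inner' C Q)
    (ε : ℝ) (hε : 0 ≤ ε) :
    ((MMOTval a μ C : ℝ) : EReal) ≤ MMOTDCval a μ part C ε ∧
      MMOTDCval a μ part C ε ≤
        ((MMOTval a μ C : ℝ) : EReal) + (ε : EReal) * KL Pstar (prodMarg a part Pstar) := by
  have hval : MMOTval a μ C = inner' C Pstar := by
    refine IsLeast.csInf_eq ⟨⟨Pstar, hPstarMem, rfl⟩, ?_⟩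
    rintro _ ⟨Q, hQ, rfl⟩
    exact hPstarMin Q hQ
  rw [hval]
  refine ⟨le_iInf₂ fun P hP => ?_, iInf₂_le Pstar hPstarMem⟩
  have h1 : (0 : EReal) ≤ (ε : EReal) * KL P (prodMarg a part P) :=
    mul_nonneg (EReal.coe_nonneg.2 hε) (KL_nonneg _ _ hP.1 (prodMarg_isProb a part P hP.1))
  have h2 : ((inner' C Pstar : ℝ) : EReal) ≤ ((inner' C P : ℝ) : EReal) :=
    EReal.coe_le_coe_iff.2 (hPstarMin P hP)
  unfold dcObj
  simpa using add_le_add h2 h1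

end MMOTPaper
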